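/- Let k ≥ 2 and let (M_n) be a sequence of integers with 1 ≤ M_n ≤ kn−1 and M_n/(kn) → c for some c ∈ (0,1). Then lim_{n→∞} P_{n,k}(S(n,k;M_n)) = k·Σ_{l=1}^{k} C(k,l)·(c/(1−c))^l·Σ_{s=1}^{∞} (1−c)^{k(s+1)}/(k(s+1)−l) + (1−c)^k·Σ_{l=1}^{k−1} C(k,l)·(c/(1−c))^l. -/

import Mathlib

open Finset Filter

open scoped Classical

/-- The sample space `Ω_{n,k}`: sequences of length `k*n` with values in `Fin n`
(the value `v : Fin n` encodes the rank `v+1`), in which each value appears exactly `k`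
times; these are the permutations of the multiset `{1^k, 2^k, …, n^k}`. -/
def multisetPerms (n k : ℕ) : Finset (Fin (k*n) → Fin n) :=
  Finset.univ.filter (fun w => ∀ v : Fin n, (Finset.univ.filter (fun i => w i = v)).card = k)

/-- The maximum (as a `0`-based value) among the first `M` entries of `w`. -/
def firstMax (n k M : ℕ) (w : Fin (k*n) → Fin n) : ℕ :=
  (Finset.univ.filter (fun t : Fin (k*n) => (t : ℕ) < M)).sup (fun t => (w t : ℕ))

/-- The strategy `S(n,k;M)` succeeds on `w`: there is an index `i` beyond the first `M`
entries whose value is `≥` the maximum of the first `M` entries, and the first such index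
carries an item of the highest rank `n`. -/
def succeedsS (n k M : ℕ) (w : Fin (k*n) → Fin n) : Prop :=
  ∃ i : Fin (k*n), M ≤ (i : ℕ) ∧ firstMax n k M w ≤ (w i : ℕ) ∧
    (∀ i' : Fin (k*n), M ≤ (i' : ℕ) → firstMax n k M w ≤ (w i' : ℕ) → i ≤ i') ∧
    (w i : ℕ) + 1 = n

/-- The strategy `S⁺(n,k;M)` succeeds on `w`: there is an index `i` beyond the first `M`
entries whose value is strictly greater than the maximum of the first `M` entries, and the
first such index carries an item of the highest rank `n`. -/
def succeedsSplus (n k M : ℕ) (w : Fin (k*n) → Fin n) : Prop :=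
  ∃ i : Fin (k*n), M ≤ (i : ℕ) ∧ firstMax n k M w < (w i : ℕ) ∧
    (∀ i' : Fin (k*n), M ≤ (i' : ℕ) → firstMax n k M w < (w i' : ℕ) → i ≤ i') ∧
    (w i : ℕ) + 1 = n

/-- `P_{n,k}(S(n,k;M))`: the probability of success of strategy `S(n,k;M)` under the
uniform measure on `Ω_{n,k}`. -/
noncomputable def probS (n k M : ℕ) : ℝ :=
  (((multisetPerms n k).filter (succeedsS n k M)).card : ℝ) / ((multisetPerms n k).card : ℝ)

/-- `P_{n,k}(S⁺(n,k;M))`: the probability of success of strategy `S⁺(n,k;M)` under the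
uniform measure on `Ω_{n,k}`. -/
noncomputable def probSplus (n k M : ℕ) : ℝ :=
  (((multisetPerms n k).filter (succeedsSplus n k M)).card : ℝ) / ((multisetPerms n k).card : ℝ)

/-- The event `A^{(n)}_{M,j,l}`: among the first `M` entries, the rank `j` appears exactly
`l` times and no rank greater than `j` appears. -/
def eventA (n k M j l : ℕ) (w : Fin (k*n) → Fin n) : Prop :=
  ((Finset.univ.filter (fun i : Fin (k*n) => (i : ℕ) < M ∧ (w i : ℕ) + 1 = j)).card = l) ∧
  ∀ i : Fin (k*n), (i : ℕ) < M → (w i : ℕ) + 1 ≤ j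

lemma card_perm_insert {N : ℕ} (P A B : Finset (Fin N)) (hAB : Disjoint A B) (a : Fin N)
    (haA : a ∉ A) (haB : a ∉ B) :
    (N - (#A + #B)) *
        #{σ : Equiv.Perm (Fin N) | (∀ x ∈ insert a A, σ x ∈ P) ∧ ∀ x ∈ B, σ x ∉ P} =
      (#P - #A) * #{σ : Equiv.Perm (Fin N) | (∀ x ∈ A, σ x ∈ P) ∧ ∀ x ∈ B, σ x ∉ P} := by
  have key := Finset.sum_card_bipartiteAbove_eq_sum_card_bipartiteBelow
    (s := (A ∪ B)ᶜ)
    (t := ({σ : Equiv.Perm (Fin N) | (∀ x ∈ A, σ x ∈ P) ∧ ∀ x ∈ B, σ x ∉ P} : Finset _))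
    (fun x σ => σ x ∈ P)
  have hleft : ∀ x ∈ (A ∪ B)ᶜ, #(Finset.bipartiteAbove (fun x (σ : Equiv.Perm (Fin N)) => σ x ∈ P)
      ({σ : Equiv.Perm (Fin N) | (∀ x ∈ A, σ x ∈ P) ∧ ∀ x ∈ B, σ x ∉ P} : Finset _) x) =
      #{σ : Equiv.Perm (Fin N) | (∀ x ∈ insert a A, σ x ∈ P) ∧ ∀ x ∈ B, σ x ∉ P} := by
    intro x hx
    simp only [mem_compl, mem_union, not_or] at hx
    have hfix : ∀ y ∈ A ∪ B, Equiv.swap x a y = y := by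
      intro y hy
      refine Equiv.swap_apply_of_ne_of_ne ?_ ?_ <;> rintro rfl <;> simp_all
    refine Finset.card_nbij' (fun σ => (Equiv.swap x a).trans σ)
      (fun σ => (Equiv.swap x a).trans σ) ?_ ?_ ?_ ?_
    · intro σ hσ
      simp only [bipartiteAbove, coe_filter, mem_filter, mem_univ, true_and, Set.mem_ofPred_eq] at hσ
      simp only [coe_filter, mem_univ, true_and, Set.mem_ofPred_eq, mem_insert, forall_eq_or_imp,
        Equiv.trans_apply, Equiv.swap_apply_right]
      refine ⟨⟨hσ.2, fun y hy => ?_⟩, fun y hy => ?_⟩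
      · rw [hfix y (by simp [hy])]; exact hσ.1.1 y hy
      · rw [hfix y (by simp [hy])]; exact hσ.1.2 y hy
    · intro σ hσ
      simp only [coe_filter, mem_univ, true_and, Set.mem_ofPred_eq, mem_insert,
        forall_eq_or_imp] at hσ
      simp only [bipartiteAbove, coe_filter, mem_filter, mem_univ, true_and, Set.mem_ofPred_eq,
        Equiv.trans_apply, Equiv.swap_apply_left]
      refine ⟨⟨fun y hy => ?_, fun y hy => ?_⟩, hσ.1.1⟩
      · rw [hfix y (by simp [hy])]; exact hσ.1.2 y hy
      · rw [hfix y (by simp [hy])]; exact hσ.2 y hy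
    · intro σ _
      ext y; simp
    · intro σ _
      ext y; simp
  have hright : ∀ σ ∈ ({σ : Equiv.Perm (Fin N) | (∀ x ∈ A, σ x ∈ P) ∧ ∀ x ∈ B, σ x ∉ P} : Finset _),
      #(Finset.bipartiteBelow (fun x (σ : Equiv.Perm (Fin N)) => σ x ∈ P) (A ∪ B)ᶜ σ) =
        #P - #A := by
    intro σ hσ
    simp only [mem_filter, mem_univ, true_and] at hσ
    have h1 : Finset.bipartiteBelow (fun x (σ : Equiv.Perm (Fin N)) => σ x ∈ P) (A ∪ B)ᶜ σ =
        P.map σ.symm.toEmbedding \ A := by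
      ext y
      simp only [bipartiteBelow, mem_filter, mem_compl, mem_union, not_or, Finset.mem_sdiff,
        Finset.mem_map_equiv, Equiv.symm_symm]
      have := hσ.2 y
      tauto
    rw [h1, card_sdiff_of_subset, card_map]
    intro y hy
    simpa using hσ.1 y hy
  rw [sum_congr rfl hleft, sum_congr rfl hright, sum_const, sum_const, card_compl,
    card_union_of_disjoint hAB, Fintype.card_fin, smul_eq_mul, smul_eq_mul] at key
  rw [key, mul_comm]

lemma card_perm_mul_descFactorial {N : ℕ} (P A B : Finset (Fin N)) (hAB : Disjoint A B) :
    #{σ : Equiv.Perm (Fin N) | (∀ x ∈ A, σ x ∈ P) ∧ ∀ x ∈ B, σ x ∉ P} *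
        N.descFactorial (#A + #B) =
      (#P).descFactorial #A * (N - #P).descFactorial #B * N.factorial := by
  induction A using Finset.induction_on with
  | empty =>
    induction B using Finset.induction_on with
    | empty => simp [Fintype.card_perm]
    | insert b B hb ih =>
      have h := card_perm_insert Pᶜ B ∅ (by simp) b hb (by simp)
      have ih := ih (by simp)
      simp only [mem_compl, notMem_empty, false_imp_iff, implies_true, and_true, true_and,
        card_empty, add_zero, zero_add, card_compl, Fintype.card_fin, Nat.descFactorial_zero,
        one_mul, card_insert_of_notMem hb, Nat.descFactorial_succ] at h ih ⊢
      rw [mul_left_comm, ← mul_assoc, h, mul_assoc, ih, mul_assoc]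
  | insert a A ha ih =>
    rw [disjoint_insert_left] at hAB
    have h := card_perm_insert P A B hAB.2 a ha hAB.1
    have ih := ih hAB.2
    rw [card_insert_of_notMem ha, add_right_comm, Nat.descFactorial_succ, Nat.descFactorial_succ,
      mul_left_comm, ← mul_assoc, h, mul_assoc, ih]
    ring

lemma card_perm_hypergeometric {N : ℕ} (P J H : Finset (Fin N)) (hJH : Disjoint J H) (l : ℕ) :
    #{σ : Equiv.Perm (Fin N) | #{x ∈ J | σ x ∈ P} = l ∧ ∀ x ∈ H, σ x ∉ P} *
        N.descFactorial (#J + #H) =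
      (#J).choose l * ((#P).descFactorial l * (N - #P).descFactorial (#J + #H - l) *
        N.factorial) := by
  rw [Finset.card_eq_sum_card_fiberwise (f := fun σ : Equiv.Perm (Fin N) => {x ∈ J | σ x ∈ P})
    (t := J.powersetCard l), sum_mul, ← card_powersetCard, ← smul_eq_mul, ← sum_const]
  · refine sum_congr rfl fun A hA => ?_
    obtain ⟨hAJ, hAl⟩ := mem_powersetCard.1 hA
    have hd : Disjoint A (J \ A ∪ H) :=
      disjoint_union_right.2 ⟨disjoint_sdiff, hJH.mono_left hAJ⟩
    have hd' : Disjoint (J \ A) H := hJH.mono_left sdiff_subset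
    have h := card_perm_mul_descFactorial P A (J \ A ∪ H) hd
    have hle := card_le_card hAJ
    rw [card_union_of_disjoint hd', card_sdiff_of_subset hAJ, hAl,
      show l + (#J - l + #H) = #J + #H by omega, show #J - l + #H = #J + #H - l by omega] at h
    rw [← h]
    congr 2
    ext σ
    simp only [mem_filter, mem_univ, true_and, mem_union, Finset.mem_sdiff]
    constructor
    · rintro ⟨⟨-, h2⟩, rfl⟩
      refine ⟨fun x hx => (mem_filter.1 hx).2, ?_⟩
      rintro x (hx | hx)
      · intro hP
        exact hx.2 (mem_filter.2 ⟨hx.1, hP⟩)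
      · exact h2 x hx
    · rintro ⟨h1, h2⟩
      have : ({x ∈ J | σ x ∈ P} : Finset _) = A := by
        ext x
        simp only [mem_filter]
        refine ⟨fun hx => ?_, fun hx => ⟨hAJ hx, h1 x hx⟩⟩
        by_contra hxA
        exact h2 x (Or.inl ⟨hx.1, hxA⟩) hx.2
      exact ⟨⟨by rw [this, hAl], fun x hx => h2 x (Or.inr hx)⟩, this⟩
  · intro σ hσ
    simp only [coe_filter, mem_univ, true_and, Set.mem_ofPred_eq] at hσ
    simp [mem_powersetCard, hσ.1]

lemma comp_perm_mem_multisetPerms {n k : ℕ} {w : Fin (k*n) → Fin n} (τ : Equiv.Perm (Fin (k*n)))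
    (hw : w ∈ multisetPerms n k) : w ∘ τ ∈ multisetPerms n k := by
  simp only [multisetPerms, mem_filter, mem_univ, true_and] at hw ⊢
  intro v
  exact (Finset.card_equiv τ (by simp)).trans (hw v)

lemma multisetPerms_nonempty (n k : ℕ) : (multisetPerms n k).Nonempty := by
  refine ⟨fun i => (finProdFinEquiv.symm i).2, ?_⟩
  simp only [multisetPerms, mem_filter, mem_univ, true_and]
  intro v
  conv_rhs => rw [← Fintype.card_fin k, ← Finset.card_univ]
  refine Finset.card_nbij' (fun i => (finProdFinEquiv.symm i).1) (fun a => finProdFinEquiv (a, v))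
    ?_ ?_ ?_ ?_
  · intro i _; simp
  · intro a _; simp [-finProdFinEquiv_apply_val, -finProdFinEquiv_symm_apply]
  · intro i hi
    simp only [coe_filter, mem_univ, true_and, Set.mem_ofPred_eq] at hi
    simp only [← hi, Prod.mk.eta, Equiv.apply_symm_apply]
  · intro a _; simp

lemma card_value_eq {n k : ℕ} {w : Fin (k*n) → Fin n} (hw : w ∈ multisetPerms n k) {j : ℕ}
    (h1 : 1 ≤ j) (hj : j ≤ n) : #{i | (w i : ℕ) + 1 = j} = k := by
  simp only [multisetPerms, mem_filter, mem_univ, true_and] at hw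
  refine Eq.trans ?_ (hw ⟨j - 1, by omega⟩)
  congr 1
  ext i
  simp only [mem_filter, mem_univ, true_and, Fin.ext_iff]
  omega

lemma card_value_ge {n k : ℕ} {w : Fin (k*n) → Fin n} (hw : w ∈ multisetPerms n k) {s : ℕ}
    (hs : s < n) : #{i | n - s ≤ (w i : ℕ) + 1} = k * (s + 1) := by
  rw [Finset.card_eq_sum_card_fiberwise (f := w) (t := Finset.Ici ⟨n - 1 - s, by omega⟩)]
  · rw [sum_congr rfl (g := fun _ => k), sum_const, Fin.card_Ici, smul_eq_mul, mul_comm]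
    · congr 1; simp only; omega
    · intro v hv
      simp only [multisetPerms, mem_filter, mem_univ, true_and] at hw
      refine Eq.trans ?_ (hw v)
      congr 1
      ext i
      simp only [mem_filter, mem_univ, true_and]
      rw [mem_Ici, Fin.le_def] at hv
      refine ⟨fun h => h.2, ?_⟩
      rintro rfl
      simp only at hv
      exact ⟨by omega, rfl⟩
  · intro i hi
    simp only [coe_filter, mem_univ, true_and, Set.mem_ofPred_eq] at hi
    simp only [coe_Ici, Set.mem_Ici, Fin.le_def]
    omega

lemma card_lt_fin {N M : ℕ} (hM : M ≤ N) : #{i : Fin N | (i : ℕ) < M} = M := by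
  rw [Fin.card_filter_val_lt, min_eq_right hM]

lemma card_perm_eventA {n k M s l : ℕ} (hM : M ≤ k * n) (hs : s < n)
    {w : Fin (k*n) → Fin n} (hw : w ∈ multisetPerms n k) :
    #{τ : Equiv.Perm (Fin (k*n)) | eventA n k M (n - s) l (w ∘ τ)} *
        (k * n).descFactorial (k * (s + 1)) =
      k.choose l * (M.descFactorial l * (k * n - M).descFactorial (k * (s + 1) - l) *
        (k * n).factorial) := by
  have hd : Disjoint ({i | (w i : ℕ) + 1 = n - s} : Finset (Fin (k*n)))
      ({i | n - s < (w i : ℕ) + 1} : Finset (Fin (k*n))) := by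
    rw [disjoint_left]
    intro i
    simp only [mem_filter, mem_univ, true_and]
    omega
  have hsum : #{i | (w i : ℕ) + 1 = n - s} + #{i | n - s < (w i : ℕ) + 1} = k * (s + 1) := by
    rw [← card_value_ge hw hs, ← card_union_of_disjoint hd]
    congr 1
    ext i
    simp only [mem_filter, mem_univ, true_and, mem_union]
    omega
  have h := card_perm_hypergeometric ({i : Fin (k*n) | (i : ℕ) < M} : Finset _) _ _ hd l
  rw [hsum, card_value_eq hw (by omega) (by omega), card_lt_fin hM] at h
  rw [← h]
  congr 1
  refine Finset.card_nbij' (fun τ => τ.symm) (fun τ => τ.symm) ?_ ?_ ?_ ?_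
  · intro τ hτ
    simp only [coe_filter, mem_filter, mem_univ, true_and, Set.mem_ofPred_eq, eventA,
      Function.comp_apply] at hτ ⊢
    refine ⟨?_, fun x hx hxM => ?_⟩
    · rw [← hτ.1]
      refine Finset.card_equiv τ.symm fun i => ?_
      simp [and_comm]
    · have := hτ.2 _ hxM
      rw [Equiv.apply_symm_apply] at this
      omega
  · intro σ hσ
    simp only [coe_filter, mem_filter, mem_univ, true_and, Set.mem_ofPred_eq, eventA,
      Function.comp_apply] at hσ ⊢
    refine ⟨?_, fun x hx => ?_⟩
    · rw [← hσ.1]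
      refine Finset.card_equiv σ.symm fun i => ?_
      simp [and_comm]
    · by_contra hlt
      exact hσ.2 (σ.symm x) (not_le.1 hlt) (by simpa using hx)
  · intro τ _; simp
  · intro τ _; simp

lemma card_eventA {n k M s l : ℕ} (hM : M ≤ k * n) (hs : s < n) :
    #{w ∈ multisetPerms n k | eventA n k M (n - s) l w} * (k * n).descFactorial (k * (s + 1)) =
      #(multisetPerms n k) *
        (k.choose l * (M.descFactorial l * (k * n - M).descFactorial (k * (s + 1) - l))) := by
  have key := Finset.sum_card_bipartiteAbove_eq_sum_card_bipartiteBelow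
    (s := multisetPerms n k) (t := (univ : Finset (Equiv.Perm (Fin (k*n)))))
    (fun w (τ : Equiv.Perm (Fin (k*n))) => eventA n k M (n - s) l (w ∘ τ))
  have hright : ∀ τ ∈ (univ : Finset (Equiv.Perm (Fin (k*n)))),
      #(bipartiteBelow (fun w (τ : Equiv.Perm (Fin (k*n))) => eventA n k M (n - s) l (w ∘ τ))
        (multisetPerms n k) τ) = #{w ∈ multisetPerms n k | eventA n k M (n - s) l w} := by
    intro τ _
    refine Finset.card_nbij' (fun w => w ∘ τ) (fun w => w ∘ τ.symm) ?_ ?_ ?_ ?_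
    · intro w hw
      simp only [bipartiteBelow, coe_filter, Set.mem_ofPred_eq] at hw ⊢
      exact ⟨comp_perm_mem_multisetPerms τ hw.1, hw.2⟩
    · intro w hw
      simp only [bipartiteBelow, coe_filter, Set.mem_ofPred_eq] at hw ⊢
      refine ⟨comp_perm_mem_multisetPerms τ.symm hw.1, ?_⟩
      simpa [Function.comp_assoc] using hw.2
    · intro w _; simp [Function.comp_assoc]
    · intro w _; simp [Function.comp_assoc]
  rw [sum_congr rfl hright, sum_const, card_univ, Fintype.card_perm, Fintype.card_fin,
    smul_eq_mul] at key
  apply Nat.eq_of_mul_eq_mul_left (k * n).factorial_pos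
  rw [← mul_assoc, ← key, sum_mul]
  simp only [bipartiteAbove]
  rw [sum_congr rfl (fun w hw => card_perm_eventA (l := l) hM hs hw), sum_const, smul_eq_mul]
  ring

/-- The positions beyond the first `M` entries carrying a rank at least `j`. -/
def candidates (n k M j : ℕ) (w : Fin (k*n) → Fin n) : Finset (Fin (k*n)) :=
  Finset.univ.filter (fun i => M ≤ (i : ℕ) ∧ j ≤ (w i : ℕ) + 1)

/-- The first candidate position, or the default `p` if there is none. -/
noncomputable def firstCandidate (n k M j : ℕ) (w : Fin (k*n) → Fin n) (p : Fin (k*n)) :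
    Fin (k*n) :=
  if h : (candidates n k M j w).Nonempty then (candidates n k M j w).min' h else p

lemma firstCandidate_mem {n k M j : ℕ} {w : Fin (k*n) → Fin n} {p : Fin (k*n)}
    (hp : p ∈ candidates n k M j w) : firstCandidate n k M j w p ∈ candidates n k M j w := by
  rw [firstCandidate, dif_pos ⟨p, hp⟩]
  exact min'_mem _ _

lemma firstMax_add_one {n k M j l : ℕ} {w : Fin (k*n) → Fin n} (hl : 1 ≤ l)
    (h : eventA n k M j l w) : firstMax n k M w + 1 = j := by
  obtain ⟨i, hi⟩ := card_pos.1 (h.1 ▸ hl : 0 < #{i : Fin (k*n) | (i : ℕ) < M ∧ (w i : ℕ) + 1 = j})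
  simp only [mem_filter, mem_univ, true_and] at hi
  have h1 : (w i : ℕ) ≤ firstMax n k M w :=
    Finset.le_sup (f := fun t => (w t : ℕ)) (by simpa using hi.1)
  have h2 : firstMax n k M w ≤ j - 1 := by
    refine Finset.sup_le fun t ht => ?_
    have := h.2 t (by simpa using ht)
    omega
  omega

lemma exists_eventA {n k M : ℕ} (hM : 1 ≤ M) (hMN : M ≤ k * n) {w : Fin (k*n) → Fin n}
    (hw : w ∈ multisetPerms n k) :
    ∃ s < n, ∃ l ∈ Finset.Icc 1 k, eventA n k M (n - s) l w := by
  have hne : ({t : Fin (k*n) | (t : ℕ) < M} : Finset _).Nonempty :=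
    ⟨⟨0, by omega⟩, by simp; omega⟩
  obtain ⟨i, hi, hmax⟩ := exists_max_image _ (fun t => (w t : ℕ)) hne
  simp only [mem_filter, mem_univ, true_and] at hi hmax
  have hlt := (w i).isLt
  refine ⟨n - 1 - w i, by omega, _, mem_Icc.2 ⟨?_, ?_⟩, rfl, fun t ht => ?_⟩
  · refine card_pos.2 ⟨i, ?_⟩
    simp only [mem_filter, mem_univ, true_and]
    omega
  · refine (card_le_card ?_).trans
      (card_value_eq hw (j := n - (n - 1 - w i)) (by omega) (by omega)).le
    intro t
    simp only [mem_filter, mem_univ, true_and]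
    exact And.right
  · have := hmax t ht
    omega

lemma succeedsS_iff {n k M j l : ℕ} {w : Fin (k*n) → Fin n} (hl : 1 ≤ l)
    (h : eventA n k M j l w) {p : Fin (k*n)} (hp : p ∈ candidates n k M j w) :
    succeedsS n k M w ↔ (w (firstCandidate n k M j w p) : ℕ) + 1 = n := by
  have hf := firstMax_add_one hl h
  have hmem : ∀ i, i ∈ candidates n k M j w ↔ M ≤ (i : ℕ) ∧ firstMax n k M w ≤ (w i : ℕ) := by
    intro i
    simp only [candidates, mem_filter, mem_univ, true_and]
    omega
  have hmin : ∀ i ∈ candidates n k M j w, firstCandidate n k M j w p ≤ i := by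
    intro i hi
    rw [firstCandidate, dif_pos ⟨p, hp⟩]
    exact min'_le _ _ hi
  have hfm := firstCandidate_mem hp
  constructor
  · rintro ⟨i, h1, h2, h3, h4⟩
    have : i = firstCandidate n k M j w p :=
      le_antisymm (h3 _ ((hmem _).1 hfm).1 ((hmem _).1 hfm).2) (hmin _ ((hmem _).2 ⟨h1, h2⟩))
    rwa [← this]
  · intro h'
    exact ⟨_, ((hmem _).1 hfm).1, ((hmem _).1 hfm).2,
      fun i h1 h2 => hmin i ((hmem _).2 ⟨h1, h2⟩), h'⟩

lemma not_succeedsS_of_candidates_eq_empty {n k M j l : ℕ} {w : Fin (k*n) → Fin n} (hl : 1 ≤ l)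
    (h : eventA n k M j l w) (hc : candidates n k M j w = ∅) : ¬ succeedsS n k M w := by
  rintro ⟨i, h1, h2, -, -⟩
  have hf := firstMax_add_one hl h
  have : i ∈ candidates n k M j w := by
    simp only [candidates, mem_filter, mem_univ, true_and]
    omega
  simp [hc] at this

lemma candidates_comp_swap {n k M j : ℕ} {w : Fin (k*n) → Fin n} {a b : Fin (k*n)}
    (ha : a ∈ candidates n k M j w) (hb : b ∈ candidates n k M j w) :
    candidates n k M j (w ∘ Equiv.swap a b) = candidates n k M j w := by
  ext i
  simp only [candidates, mem_filter, mem_univ, true_and, Function.comp_apply] at ha hb ⊢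
  rw [Equiv.swap_apply_def]
  split_ifs <;> simp_all

lemma eventA_comp_swap {n k M j l : ℕ} {w : Fin (k*n) → Fin n} {a b : Fin (k*n)}
    (ha : M ≤ (a : ℕ)) (hb : M ≤ (b : ℕ)) (h : eventA n k M j l w) :
    eventA n k M j l (w ∘ Equiv.swap a b) := by
  have hfix : ∀ i : Fin (k*n), (i : ℕ) < M → Equiv.swap a b i = i := by
    intro i hi
    refine Equiv.swap_apply_of_ne_of_ne ?_ ?_ <;> rintro rfl <;> omega
  refine ⟨h.1 ▸ ?_, fun i hi => ?_⟩
  · congr 1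
    ext i
    simp only [mem_filter, mem_univ, true_and, Function.comp_apply]
    exact and_congr_right fun hi => by rw [hfix i hi]
  · rw [Function.comp_apply, hfix i hi]
    exact h.2 i hi

lemma firstCandidate_congr {n k M j : ℕ} {w w' : Fin (k*n) → Fin n} {p : Fin (k*n)}
    (h : candidates n k M j w = candidates n k M j w') :
    firstCandidate n k M j w p = firstCandidate n k M j w' p := by
  simp only [firstCandidate, h]

lemma card_success_pairs {n k M j l : ℕ} (hl : 1 ≤ l) (hj : j ≤ n) :
    ∑ w ∈ multisetPerms n k with eventA n k M j l w ∧ succeedsS n k M w,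
        #(candidates n k M j w) =
      ∑ w ∈ multisetPerms n k with eventA n k M j l w, #{p : Fin (k*n) | M ≤ (p : ℕ) ∧ (w p : ℕ) + 1 = n} := by
  rw [← card_sigma, ← card_sigma]
  have hsub : ∀ (w : Fin (k*n) → Fin n) (p : Fin (k*n)), M ≤ (p : ℕ) → (w p : ℕ) + 1 = n →
      p ∈ candidates n k M j w := by
    intro w p h1 h2
    simp only [candidates, mem_filter, mem_univ, true_and]
    omega
  have hM : ∀ (w : Fin (k*n) → Fin n) (p : Fin (k*n)), p ∈ candidates n k M j w →
      M ≤ (p : ℕ) := fun w p hp => (mem_filter.1 hp).2.1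
  have hinv : ∀ (w : Fin (k*n) → Fin n) (p : Fin (k*n)), p ∈ candidates n k M j w →
      candidates n k M j (w ∘ Equiv.swap (firstCandidate n k M j w p) p) = candidates n k M j w :=
    fun w p hp => candidates_comp_swap (firstCandidate_mem hp) hp
  have hcancel : ∀ (x : Σ _ : Fin (k*n) → Fin n, Fin (k*n)), x.2 ∈ candidates n k M j x.1 →
      (⟨(x.1 ∘ Equiv.swap (firstCandidate n k M j x.1 x.2) x.2) ∘
        Equiv.swap (firstCandidate n k M j
          (x.1 ∘ Equiv.swap (firstCandidate n k M j x.1 x.2) x.2) x.2) x.2, x.2⟩ :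
        Σ _ : Fin (k*n) → Fin n, Fin (k*n)) = x := by
    rintro ⟨w, p⟩ hp
    rw [firstCandidate_congr (hinv w p hp)]
    congr 1
    ext i
    simp
  refine Finset.card_nbij'
    (fun x => ⟨x.1 ∘ Equiv.swap (firstCandidate n k M j x.1 x.2) x.2, x.2⟩)
    (fun x => ⟨x.1 ∘ Equiv.swap (firstCandidate n k M j x.1 x.2) x.2, x.2⟩) ?_ ?_ ?_ ?_
  · rintro ⟨w, p⟩ hx
    simp only [coe_sigma, coe_filter, Set.mem_sigma_iff, Set.mem_ofPred_eq, mem_coe, mem_univ,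
      true_and, Function.comp_apply, Equiv.swap_apply_right] at hx ⊢
    obtain ⟨⟨hw, hE, hS⟩, hp⟩ := hx
    have hf := firstCandidate_mem hp
    exact ⟨⟨comp_perm_mem_multisetPerms _ hw, eventA_comp_swap (hM _ _ hf) (hM _ _ hp) hE⟩,
      hM _ _ hp, (succeedsS_iff hl hE hp).1 hS⟩
  · rintro ⟨w, p⟩ hx
    simp only [coe_sigma, coe_filter, Set.mem_sigma_iff, Set.mem_ofPred_eq, mem_coe, mem_univ,
      true_and] at hx ⊢
    obtain ⟨⟨hw, hE⟩, hpM, hpn⟩ := hx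
    have hp := hsub w p hpM hpn
    have hf := firstCandidate_mem hp
    have hE' := eventA_comp_swap (hM _ _ hf) (hM _ _ hp) hE
    have hp' := hp
    rw [← hinv w p hp] at hp'
    refine ⟨⟨comp_perm_mem_multisetPerms _ hw, hE', ?_⟩, hp'⟩
    rw [succeedsS_iff hl hE' hp', firstCandidate_congr (hinv w p hp)]
    simpa using hpn
  · rintro x hx
    simp only [coe_sigma, coe_filter, Set.mem_sigma_iff, mem_coe] at hx
    exact hcancel x hx.2
  · rintro x hx
    simp only [coe_sigma, coe_filter, Set.mem_sigma_iff, Set.mem_ofPred_eq, mem_univ,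
      true_and] at hx
    exact hcancel x (hsub _ _ hx.2.1 hx.2.2)

lemma card_candidates {n k M s l : ℕ} (hs : s < n) {w : Fin (k*n) → Fin n}
    (hw : w ∈ multisetPerms n k) (h : eventA n k M (n - s) l w) :
    #(candidates n k M (n - s) w) = k * (s + 1) - l := by
  rw [← card_value_ge hw hs, ← h.1, ← card_sdiff_of_subset]
  · congr 1
    ext i
    have := h.2 i
    simp only [candidates, mem_filter, mem_univ, true_and, Finset.mem_sdiff]
    omega
  · intro i
    simp only [mem_filter, mem_univ, true_and]
    omega

lemma card_top_rank {n k M s l : ℕ} (hs : s < n) {w : Fin (k*n) → Fin n}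
    (hw : w ∈ multisetPerms n k) (h : eventA n k M (n - s) l w) :
    #{p : Fin (k*n) | M ≤ (p : ℕ) ∧ (w p : ℕ) + 1 = n} = if s = 0 then k - l else k := by
  split_ifs with h0
  · subst h0
    have := card_candidates hs hw h
    simp only [zero_add, mul_one] at this
    rw [← this]
    congr 1
    ext i
    simp only [candidates, mem_filter, mem_univ, true_and]
    omega
  · refine Eq.trans ?_ (card_value_eq hw (j := n) (by omega) le_rfl)
    congr 1
    ext i
    have := h.2 i
    simp only [mem_filter, mem_univ, true_and]
    omega

lemma card_eventA_succeedsS {n k M s l : ℕ} (hl : 1 ≤ l) (hs : s < n) :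
    (#{w ∈ multisetPerms n k | eventA n k M (n - s) l w ∧ succeedsS n k M w} : ℝ) =
      ((if s = 0 then k - l else k : ℕ) : ℝ) / ((k * (s + 1) - l : ℕ) : ℝ) *
        #{w ∈ multisetPerms n k | eventA n k M (n - s) l w} := by
  have key := card_success_pairs (k := k) (M := M) hl (Nat.sub_le n s)
  rw [sum_congr rfl (g := fun _ => k * (s + 1) - l), sum_const, smul_eq_mul,
    sum_congr rfl (g := fun _ => if s = 0 then k - l else k), sum_const, smul_eq_mul] at key
  · rcases Nat.eq_zero_or_pos (k * (s + 1) - l) with h0 | hpos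
    · rw [h0, Nat.cast_zero, div_zero, zero_mul, Nat.cast_eq_zero, card_eq_zero,
        filter_eq_empty_iff]
      rintro w hw ⟨hE, hS⟩
      exact not_succeedsS_of_candidates_eq_empty hl hE
        (card_eq_zero.1 ((card_candidates hs hw hE).trans h0)) hS
    · have key : (_ : ℝ) = _ := congrArg Nat.cast key
      rw [Nat.cast_mul, Nat.cast_mul] at key
      have : ((k * (s + 1) - l : ℕ) : ℝ) ≠ 0 := by positivity
      field_simp
      linarith
  · intro w hw
    rw [mem_filter] at hw
    exact card_top_rank hs hw.1 hw.2
  · intro w hw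
    rw [mem_filter] at hw
    exact card_candidates hs hw.1 hw.2.1

lemma probS_eq_sum {n k M : ℕ} (hM : 1 ≤ M) (hMN : M ≤ k * n) :
    probS n k M = ∑ s ∈ range n, ∑ l ∈ Finset.Icc 1 k,
      ((if s = 0 then k - l else k : ℕ) : ℝ) / ((k * (s + 1) - l : ℕ) : ℝ) *
        ((k.choose l : ℝ) * ((M.descFactorial l : ℝ) *
          ((k * n - M).descFactorial (k * (s + 1) - l) : ℝ) /
            ((k * n).descFactorial (k * (s + 1)) : ℝ))) := by
  have hcard : #{w ∈ multisetPerms n k | succeedsS n k M w} =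
      ∑ x ∈ range n ×ˢ Finset.Icc 1 k,
        #{w ∈ multisetPerms n k | eventA n k M (n - x.1) x.2 w ∧ succeedsS n k M w} := by
    rw [← card_biUnion]
    · congr 1
      ext w
      simp only [mem_filter, mem_biUnion, mem_product, mem_range, Prod.exists]
      constructor
      · rintro ⟨hw, hS⟩
        obtain ⟨s, hs, l, hl, hE⟩ := exists_eventA hM hMN hw
        exact ⟨s, l, ⟨hs, hl⟩, hw, hE, hS⟩
      · rintro ⟨s, l, -, hw, -, hS⟩
        exact ⟨hw, hS⟩
    · rintro ⟨s, l⟩ hx ⟨s', l'⟩ hx' hne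
      simp only [coe_product, coe_range, coe_Icc, Set.mem_prod, Set.mem_Iio, Set.mem_Icc] at hx hx'
      rw [Function.onFun, disjoint_left]
      intro w hw hw'
      simp only [mem_filter] at hw hw'
      have h1 := firstMax_add_one hx.2.1 hw.2.1
      have h2 := firstMax_add_one hx'.2.1 hw'.2.1
      have hs : s = s' := by omega
      subst hs
      exact hne (by rw [← hw.2.1.1, ← hw'.2.1.1])
  have hΩ : (#(multisetPerms n k) : ℝ) ≠ 0 := by
    exact_mod_cast (card_pos.2 (multisetPerms_nonempty n k)).ne'
  rw [probS, hcard, sum_product, Nat.cast_sum, sum_div]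
  refine sum_congr rfl fun s hs => ?_
  rw [Nat.cast_sum, sum_div]
  refine sum_congr rfl fun l hl => ?_
  have hs := mem_range.1 hs
  simp only
  rw [card_eventA_succeedsS (mem_Icc.1 hl).1 hs, mul_div_assoc]
  congr 1
  have hdf : ((k * n).descFactorial (k * (s + 1)) : ℝ) ≠ 0 := by
    have : k * (s + 1) ≤ k * n := Nat.mul_le_mul_left k hs
    exact_mod_cast (Nat.descFactorial_pos.2 this).ne'
  have h : (_ : ℝ) = _ := congrArg Nat.cast (card_eventA (l := l) hMN hs)
  push_cast at h
  rw [div_eq_iff hΩ, eq_comm, ← mul_div_assoc, div_mul_eq_mul_div, div_eq_iff hdf, h]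
  ring

lemma tendsto_descFactorial_div_pow {a b : ℕ → ℕ} {x : ℝ} (hb : Tendsto b atTop atTop)
    (hab : Tendsto (fun n => (a n : ℝ) / b n) atTop (nhds x)) (r : ℕ) :
    Tendsto (fun n => ((a n).descFactorial r : ℝ) / (b n : ℝ) ^ r) atTop (nhds (x ^ r)) := by
  have hb' : Tendsto (fun n => (b n : ℝ)) atTop atTop := tendsto_natCast_atTop_atTop.comp hb
  induction r with
  | zero => simp
  | succ r ih =>
    have hstep : Tendsto (fun n => ((a n - r : ℕ) : ℝ) / b n) atTop (nhds x) := by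
      have hlow : Tendsto (fun n => (a n : ℝ) / b n - r / b n) atTop (nhds x) := by
        simpa using hab.sub (hb'.const_div_atTop (r : ℝ))
      refine tendsto_of_tendsto_of_tendsto_of_le_of_le hlow hab (fun n => ?_) (fun n => ?_)
      · simp only
        rw [← sub_div]
        gcongr
        have : (a n : ℝ) ≤ ((a n - r : ℕ) : ℝ) + r := by exact_mod_cast (by omega)
        linarith
      · simp only
        gcongr
        exact Nat.sub_le _ _
    refine (hstep.mul ih).congr (fun n => ?_) |>.trans_eq ?_
    · rw [Nat.descFactorial_succ, Nat.cast_mul, pow_succ', mul_div_mul_comm]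
    · rw [pow_succ']

lemma descFactorial_mul_pow_le {a N : ℕ} (h : a ≤ N) (r : ℕ) :
    a.descFactorial r * N ^ r ≤ a ^ r * N.descFactorial r := by
  induction r with
  | zero => simp
  | succ r ih =>
    have hstep : (a - r) * N ≤ a * (N - r) := by
      rw [Nat.sub_mul, Nat.mul_sub]
      have := Nat.mul_le_mul_left r h
      rw [mul_comm a r]
      omega
    calc (a.descFactorial (r + 1)) * N ^ (r + 1)
        = ((a - r) * N) * (a.descFactorial r * N ^ r) := by
          rw [Nat.descFactorial_succ, pow_succ]; ring
      _ ≤ (a * (N - r)) * (a ^ r * N.descFactorial r) := Nat.mul_le_mul hstep ih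
      _ = _ := by rw [Nat.descFactorial_succ, pow_succ]; ring

lemma hypergeometric_le_pow {N M m l : ℕ} (hM : M ≤ N) (hl : l ≤ m) (hm : m ≤ N) :
    (M.descFactorial l : ℝ) * ((N - M).descFactorial (m - l) : ℝ) / (N.descFactorial m : ℝ) ≤
      (((N - M : ℕ) : ℝ) / N) ^ (m - l) := by
  have hpos : 0 < N.descFactorial m := Nat.descFactorial_pos.2 hm
  rcases lt_or_ge (N - M) (m - l) with hlt | hge
  · rw [Nat.descFactorial_of_lt hlt]
    simp only [Nat.cast_zero, mul_zero, zero_div]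
    positivity
  · rcases Nat.eq_zero_or_pos N with rfl | hN
    · obtain rfl : m = 0 := by omega
      obtain rfl : l = 0 := by omega
      simp
    rw [div_pow, div_le_div_iff₀ (by exact_mod_cast hpos) (by positivity)]
    norm_cast
    rw [← Nat.descFactorial_mul_descFactorial (Nat.sub_le m l), Nat.sub_sub_self hl]
    calc M.descFactorial l * (N - M).descFactorial (m - l) * N ^ (m - l)
        = M.descFactorial l * ((N - M).descFactorial (m - l) * N ^ (m - l)) := by ring
      _ ≤ (N - (m - l)).descFactorial l * ((N - M) ^ (m - l) * N.descFactorial (m - l)) :=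
          Nat.mul_le_mul (Nat.descFactorial_le l (by omega))
            (descFactorial_mul_pow_le (Nat.sub_le N M) _)
      _ = _ := by ring

lemma success_ratio_le_one {k l s : ℕ} (hl : l ≤ k) :
    ((if s = 0 then k - l else k : ℕ) : ℝ) / ((k * (s + 1) - l : ℕ) : ℝ) ≤ 1 := by
  refine div_le_one_of_le₀ ?_ (Nat.cast_nonneg _)
  rw [Nat.cast_le]
  split_ifs with h
  · simp [h]
  · have : k * 1 ≤ k * s := Nat.mul_le_mul_left k (Nat.pos_of_ne_zero h)
    rw [Nat.mul_add]
    omega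

lemma le_exponent {k l s : ℕ} (hk : 1 ≤ k) (hl : l ≤ k) : s ≤ k * (s + 1) - l := by
  have : 1 * s ≤ k * s := Nat.mul_le_mul_right s hk
  rw [Nat.mul_add]
  omega

lemma tsum_limit_eq {k : ℕ} (hk : 1 ≤ k) {c : ℝ} (hc : c ∈ Set.Ioo (0:ℝ) 1) :
    ∑' s : ℕ, ∑ l ∈ Finset.Icc 1 k,
      ((if s = 0 then k - l else k : ℕ) : ℝ) / ((k * (s + 1) - l : ℕ) : ℝ) *
        ((k.choose l : ℝ) * (c ^ l * (1 - c) ^ (k * (s + 1) - l))) =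
      (k : ℝ) * ∑ l ∈ Finset.Icc 1 k, (k.choose l : ℝ) * (c/(1-c))^l *
          ∑' s : ℕ, (1-c)^(k*(s+2)) / (((k*(s+2) : ℕ) : ℝ) - (l : ℝ))
        + (1-c)^k * ∑ l ∈ Finset.Icc 1 (k-1), (k.choose l : ℝ) * (c/(1-c))^l := by
  obtain ⟨hc0, hc1⟩ := hc
  have h0 : 0 < 1 - c := by linarith
  have hpow : ∀ {l m : ℕ}, l ≤ m → c ^ l * (1 - c) ^ (m - l) = (c / (1 - c)) ^ l * (1 - c) ^ m := by
    intro l m hlm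
    rw [pow_sub₀ _ h0.ne' hlm, div_pow]
    field_simp
  have hsum : ∀ l ∈ Finset.Icc 1 k, Summable fun s : ℕ =>
      ((if s = 0 then k - l else k : ℕ) : ℝ) / ((k * (s + 1) - l : ℕ) : ℝ) *
        ((k.choose l : ℝ) * (c ^ l * (1 - c) ^ (k * (s + 1) - l))) := by
    intro l hl
    have hl := (mem_Icc.1 hl).2
    refine Summable.of_nonneg_of_le (fun s => by positivity) (fun s => ?_)
      ((summable_geometric_of_lt_one h0.le (by linarith)).mul_left (k.choose l : ℝ))
    calc _ ≤ 1 * ((k.choose l : ℝ) * (1 * (1 - c) ^ s)) := by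
          gcongr ?_ * (_ * (?_ * ?_))
          · exact success_ratio_le_one hl
          · exact pow_le_one₀ hc0.le hc1.le
          · exact pow_le_pow_of_le_one h0.le (by linarith) (le_exponent hk hl)
      _ = _ := by ring
  rw [Summable.tsum_finsetSum hsum, sum_congr rfl fun l hl => (hsum l hl).tsum_eq_zero_add,
    sum_add_distrib, add_comm]
  congr 1
  · rw [mul_sum]
    refine sum_congr rfl fun l hl => ?_
    rw [← tsum_mul_left, ← tsum_mul_left]
    refine tsum_congr fun s => ?_
    have hle : l ≤ k * (s + 2) := (mem_Icc.1 hl).2.trans (Nat.le_mul_of_pos_right k (by omega))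
    rw [if_neg (Nat.succ_ne_zero s), show s + 1 + 1 = s + 2 from rfl, hpow hle, Nat.cast_sub hle]
    ring
  · obtain ⟨k, rfl⟩ := Nat.exists_eq_add_of_le' hk
    rw [sum_Icc_succ_top (by omega), Nat.add_sub_cancel]
    simp only [if_true, zero_add, mul_one, Nat.sub_self, Nat.cast_zero, zero_div, zero_mul,
      add_zero]
    rw [mul_sum]
    refine sum_congr rfl fun l hl => ?_
    have hl := (mem_Icc.1 hl).2
    have : ((k + 1 - l : ℕ) : ℝ) ≠ 0 := by
      rw [Nat.cast_ne_zero]; omega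
    rw [div_self this, hpow (by omega)]
    ring

/-- Equation (3.15): the limiting success probability of `S(n,k;M_n)` in series form. -/
theorem secretary_multirank_limit_series_form (k : ℕ) (hk : 2 ≤ k) (c : ℝ)
    (hc : c ∈ Set.Ioo (0:ℝ) 1)
    (M : ℕ → ℕ) (hM : ∀ n, 1 ≤ n → 1 ≤ M n ∧ M n ≤ k*n - 1)
    (hlim : Tendsto (fun n : ℕ => (M n : ℝ) / ((k : ℝ) * n)) atTop (nhds c)) :
    Tendsto (fun n : ℕ => probS n k (M n)) atTop
      (nhds ((k : ℝ) * ∑ l ∈ Finset.Icc 1 k, (k.choose l : ℝ) * (c/(1-c))^l *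
          ∑' s : ℕ, (1-c)^(k*(s+2)) / (((k*(s+2) : ℕ) : ℝ) - (l : ℝ))
        + (1-c)^k * ∑ l ∈ Finset.Icc 1 (k-1), (k.choose l : ℝ) * (c/(1-c))^l)) := by
  have hk1 : 1 ≤ k := by omega
  obtain ⟨hc0, hc1⟩ := hc
  have hMN : ∀ n, 1 ≤ n → M n ≤ k * n := fun n hn => (hM n hn).2.trans (Nat.sub_le _ _)
  have hN : Tendsto (fun n => k * n) atTop atTop := tendsto_id.const_mul_atTop' hk1
  have hlimM : Tendsto (fun n : ℕ => (M n : ℝ) / ((k * n : ℕ) : ℝ)) atTop (nhds c) := by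
    simpa using hlim
  have hratio : ∀ n, 1 ≤ n → ((k * n - M n : ℕ) : ℝ) / ((k * n : ℕ) : ℝ) =
      1 - (M n : ℝ) / ((k * n : ℕ) : ℝ) := by
    intro n hn
    have : ((k * n : ℕ) : ℝ) ≠ 0 := by
      rw [Nat.cast_ne_zero]; positivity
    rw [Nat.cast_sub (hMN n hn), sub_div, div_self this]
  have hlimR : Tendsto (fun n : ℕ => ((k * n - M n : ℕ) : ℝ) / ((k * n : ℕ) : ℝ)) atTop
      (nhds (1 - c)) := by
    refine (hlimM.const_sub 1).congr' ?_
    filter_upwards [eventually_ge_atTop 1] with n hn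
    rw [hratio n hn]
  have hlimN : Tendsto (fun n : ℕ => ((k * n : ℕ) : ℝ) / ((k * n : ℕ) : ℝ)) atTop (nhds 1) := by
    refine tendsto_const_nhds.congr' ?_
    filter_upwards [eventually_ge_atTop 1] with n hn
    rw [div_self]
    rw [Nat.cast_ne_zero]; positivity
  rw [← tsum_limit_eq hk1 ⟨hc0, hc1⟩]
  have hρ0 : 0 ≤ 1 - c / 2 := by linarith
  have hρ1 : 1 - c / 2 < 1 := by linarith
  refine (tendsto_tsum_of_dominated_convergence
    (f := fun n s => if s ∈ range n then ∑ l ∈ Finset.Icc 1 k,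
      ((if s = 0 then k - l else k : ℕ) : ℝ) / ((k * (s + 1) - l : ℕ) : ℝ) *
        ((k.choose l : ℝ) * (((M n).descFactorial l : ℝ) *
          ((k * n - M n).descFactorial (k * (s + 1) - l) : ℝ) /
            ((k * n).descFactorial (k * (s + 1)) : ℝ))) else 0)
    (bound := fun s => ∑ l ∈ Finset.Icc 1 k, (k.choose l : ℝ) * (1 - c / 2) ^ s)
    ?_ ?_ ?_).congr' ?_
  · exact summable_sum fun l _ => (summable_geometric_of_lt_one hρ0 hρ1).mul_left _
  · intro s
    have hlim_s : Tendsto (fun n => ∑ l ∈ Finset.Icc 1 k,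
        ((if s = 0 then k - l else k : ℕ) : ℝ) / ((k * (s + 1) - l : ℕ) : ℝ) *
          ((k.choose l : ℝ) * (((M n).descFactorial l : ℝ) *
            ((k * n - M n).descFactorial (k * (s + 1) - l) : ℝ) /
              ((k * n).descFactorial (k * (s + 1)) : ℝ)))) atTop
        (nhds (∑ l ∈ Finset.Icc 1 k,
          ((if s = 0 then k - l else k : ℕ) : ℝ) / ((k * (s + 1) - l : ℕ) : ℝ) *
            ((k.choose l : ℝ) * (c ^ l * (1 - c) ^ (k * (s + 1) - l))))) := by
      refine tendsto_finsetSum _ fun l hl => ((Tendsto.congr' ?_ (((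
        (tendsto_descFactorial_div_pow hN hlimM l).mul
        (tendsto_descFactorial_div_pow hN hlimR (k * (s + 1) - l))).div
        (tendsto_descFactorial_div_pow hN hlimN (k * (s + 1))) (by simp)).trans_eq
          (by simp))).const_mul _).const_mul _
      filter_upwards [eventually_ge_atTop 1] with n hn
      have hne : ((k * n : ℕ) : ℝ) ≠ 0 := by
        rw [Nat.cast_ne_zero]; positivity
      have hle : l ≤ k * (s + 1) :=
        (mem_Icc.1 hl).2.trans (Nat.le_mul_of_pos_right k (by omega))
      simp only [Pi.div_apply]
      rw [div_mul_div_comm, ← pow_add, Nat.add_sub_cancel' hle,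
        div_div_div_cancel_right₀ (pow_ne_zero _ hne)]
    refine hlim_s.congr' ?_
    filter_upwards [eventually_gt_atTop s] with n hn
    rw [if_pos (mem_range.2 hn)]
  · filter_upwards [eventually_ge_atTop 1,
      hlimR.eventually_le_const (show 1 - c < 1 - c / 2 by linarith)] with n hn hle s
    by_cases hs : s ∈ range n
    · simp only [if_pos hs]
      rw [Real.norm_of_nonneg (by positivity)]
      refine sum_le_sum fun l hl => ?_
      have hl := (mem_Icc.1 hl).2
      have hm : k * (s + 1) ≤ k * n := Nat.mul_le_mul_left k (mem_range.1 hs)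
      calc _ ≤ 1 * ((k.choose l : ℝ) * (1 - c / 2) ^ s) := by
            gcongr ?_ * (_ * ?_)
            · exact success_ratio_le_one hl
            · calc _ ≤ (((k * n - M n : ℕ) : ℝ) / ((k * n : ℕ) : ℝ)) ^ (k * (s + 1) - l) :=
                    hypergeometric_le_pow (hMN n hn)
                      (hl.trans (Nat.le_mul_of_pos_right k (by omega))) hm
                _ ≤ (1 - c / 2) ^ (k * (s + 1) - l) := by gcongr
                _ ≤ (1 - c / 2) ^ s :=
                    pow_le_pow_of_le_one hρ0 hρ1.le (le_exponent hk1 hl)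
        _ = _ := one_mul _
    · simp only [if_neg hs, norm_zero]
      positivity
  · filter_upwards [eventually_ge_atTop 1] with n hn
    rw [probS_eq_sum (hM n hn).1 (hMN n hn), tsum_eq_sum (s := range n)]
    · exact sum_congr rfl fun s hs => if_pos hs
    · intro s hs
      exact if_neg hs
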